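/- Fix 0 < p ≤ 1/2, an integer d ≥ 1, a fixed H₁ ∈ F₂^{n̄×n}, and let the entries of H₂,…,H_d be i.i.d. Bernoulli(p). Then for every integer 1 ≤ w ≤ nd: (i) E[numW(w,d)] ≤ C(nd,w)·(1−p)^{n̄(d−1)}, where C(·,·) is the binomial coefficient; and (ii) for every θ > 0, P(numW(w,d) > 2^{θw}) ≤ (1−p)^{−n̄} · 2^{−nd·(θ·w/(nd) − H(w/(nd)) + (1−R)·log₂(1/(1−p)))}. -/

import Mathlib

/-!
STATEMENT 6: With `H₂,…,H_d` i.i.d. Bernoulli(p), `0 < p ≤ 1/2`, for every `1 ≤ w ≤ nd`: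
(i) `E[numW(w,d)] ≤ C(nd,w)·(1−p)^{n̄(d−1)}`; and (ii) for every `θ > 0`,
`P(numW(w,d) > 2^{θw}) ≤ (1−p)^{−n̄} · 2^{−nd(θw/nd − H(w/nd) + (1−R)log₂(1/(1−p)))}`.
-/

open scoped BigOperators

/-- Binary entropy function in bits (with `H(0) = H(1) = 0`, since `Real.logb 2 0 = 0`). -/
noncomputable def binH (x : ℝ) : ℝ := -(x * Real.logb 2 x) - (1 - x) * Real.logb 2 (1 - x)

/-- The `n̄d × nd` block lower-triangular Toeplitz matrix `𝐇_d` whose `(i,j)`-th block is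
`H (i−j+1)` for `i ≥ j` and `0` otherwise (blocks are indexed from `0`, so the block
sequence used is `H 1, H 2, …, H d`). -/
def toep (nb n : ℕ) (H : ℕ → Matrix (Fin nb) (Fin n) (ZMod 2)) (d : ℕ) :
    Matrix (Fin d × Fin nb) (Fin d × Fin n) (ZMod 2) :=
  fun p q => if (q.1 : ℕ) ≤ (p.1 : ℕ) then H ((p.1 : ℕ) - (q.1 : ℕ) + 1) p.2 q.2 else 0

/-- A block vector `(c₁, …, c_d) ∈ (F₂ⁿ)^d` flattened into a vector indexed by `Fin d × Fin n`. -/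
def flat {d n : ℕ} (c : Fin d → Fin n → ZMod 2) : Fin d × Fin n → ZMod 2 :=
  fun q => c q.1 q.2

/-- Hamming weight `‖c‖` of a block vector. -/
def wt {d n : ℕ} (c : Fin d → Fin n → ZMod 2) : ℕ := hammingNorm (flat c)

/-- `C_d = {c ∈ (F₂ⁿ)^d : 𝐇_d c = 0 and c₁ ≠ 0}`. -/
def Cset (nb n : ℕ) (H : ℕ → Matrix (Fin nb) (Fin n) (ZMod 2)) (d : ℕ) (hd : 0 < d) :
    Finset (Fin d → Fin n → ZMod 2) :=
  Finset.univ.filter fun c =>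
    Matrix.mulVec (toep nb n H d) (flat c) = 0 ∧ c ⟨0, hd⟩ ≠ 0

/-- `numW(w,d) = #{c ∈ C_d : ‖c‖ = w}`. -/
def numW (nb n : ℕ) (H : ℕ → Matrix (Fin nb) (Fin n) (ZMod 2)) (d : ℕ) (hd : 0 < d)
    (w : ℕ) : ℕ :=
  ((Cset nb n H d hd).filter fun c => wt c = w).card

/-- Bernoulli(p) weight of a binary matrix: each entry is `1` w.p. `p`, `0` w.p. `1−p`. -/
noncomputable def matWt (p : ℝ) {nb n : ℕ} (M : Matrix (Fin nb) (Fin n) (ZMod 2)) : ℝ :=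
  ∏ a : Fin nb, ∏ b : Fin n, if M a b = 1 then p else 1 - p

/-- The i.i.d. product weight of a finite tuple of binary matrices. -/
noncomputable def tupWt (p : ℝ) {ι : Type} [Fintype ι] {nb n : ℕ}
    (ω : ι → Matrix (Fin nb) (Fin n) (ZMod 2)) : ℝ := ∏ i, matWt p (ω i)

/-- The random block sequence in the ensemble `TZ_p`: block `1` is the fixed matrix `H1`,
blocks `τ ≥ 2` are random (given by the sample point `ω`; the slots `ω 0, ω 1` are
unused, so summing their Bernoulli weights out leaves the probability unchanged). -/
def seq {nb n : ℕ} (H1 : Matrix (Fin nb) (Fin n) (ZMod 2)) {D : ℕ}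
    (ω : Fin (D + 1) → Matrix (Fin nb) (Fin n) (ZMod 2)) :
    ℕ → Matrix (Fin nb) (Fin n) (ZMod 2) :=
  fun τ => if τ = 1 then H1 else if h2 : τ < D + 1 then ω ⟨τ, h2⟩ else 0

open scoped Classical in
/-- Probability, over the blocks `H₂, …, H_{D}` having i.i.d. Bernoulli(p) entries,
of an event `S` (a sum of i.i.d. product weights over the finite sample space). -/
noncomputable def prOmega (p : ℝ) {nb n : ℕ} (D : ℕ)
    (S : (Fin (D + 1) → Matrix (Fin nb) (Fin n) (ZMod 2)) → Prop) : ℝ :=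
  ∑ ω : Fin (D + 1) → Matrix (Fin nb) (Fin n) (ZMod 2), if S ω then tupWt p ω else 0

noncomputable def bw (p : ℝ) (x : ZMod 2) : ℝ := if x = 1 then p else 1 - p

lemma bw_nonneg {p : ℝ} (hp0 : 0 < p) (hp : p ≤ 1 / 2) (x : ZMod 2) : 0 ≤ bw p x := by
  unfold bw; split_ifs <;> linarith

lemma bw_le {p : ℝ} (hp : p ≤ 1 / 2) (x : ZMod 2) : bw p x ≤ 1 - p := by
  unfold bw; split_ifs <;> linarith

lemma bw_sum (p : ℝ) : ∑ x : ZMod 2, bw p x = 1 := by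
  have : (Finset.univ : Finset (ZMod 2)) = {0, 1} := by decide
  rw [this, Finset.sum_pair (by decide)]
  simp [bw]

lemma core_bound {ι : Type} [Fintype ι] [DecidableEq ι] {p : ℝ} (hp0 : 0 < p) (hp : p ≤ 1 / 2)
    (P : Finset ι) (S : Finset (ι → ZMod 2))
    (hS : ∀ x ∈ S, ∀ y ∈ S, (∀ i, i ∉ P → x i = y i) → x = y) :
    ∑ x ∈ S, ∏ i, bw p (x i) ≤ (1 - p) ^ P.card := by
  classical
  let r : (ι → ZMod 2) → ({i // i ∉ P} → ZMod 2) := fun x i => x i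
  have hr : Set.InjOn r (S : Set (ι → ZMod 2)) := by
    intro x hx y hy hxy
    exact hS x hx y hy fun i hi => congrFun hxy ⟨i, hi⟩
  have hsplit : ∀ x : ι → ZMod 2, ∏ i, bw p (x i) ≤
      (1 - p) ^ P.card * ∏ i, bw p (r x i) := by
    intro x
    rw [← Fintype.prod_subtype_mul_prod_subtype (fun i => i ∈ P) (fun i => bw p (x i))]
    refine mul_le_mul_of_nonneg_right ?_ (Finset.prod_nonneg fun i _ => bw_nonneg hp0 hp _)
    refine (Finset.prod_le_prod (fun i _ => bw_nonneg hp0 hp _) (fun i _ => bw_le hp _)).trans ?_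
    rw [Finset.prod_const]
    refine le_of_eq (congrArg _ ?_)
    convert (Finset.card_univ (α := P)).trans (Fintype.card_coe P)
  calc ∑ x ∈ S, ∏ i, bw p (x i) ≤ ∑ x ∈ S, (1 - p) ^ P.card * ∏ i, bw p (r x i) :=
        Finset.sum_le_sum fun x _ => hsplit x
    _ = (1 - p) ^ P.card * ∑ y ∈ S.image r, ∏ i, bw p (y i) := by
        rw [Finset.sum_image hr, Finset.mul_sum]
    _ ≤ (1 - p) ^ P.card * ∑ y : {i // i ∉ P} → ZMod 2, ∏ i, bw p (y i) := by
        refine mul_le_mul_of_nonneg_left ?_ (pow_nonneg (by linarith) _)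
        exact Finset.sum_le_sum_of_subset_of_nonneg (Finset.subset_univ _)
          fun y _ _ => Finset.prod_nonneg fun i _ => bw_nonneg hp0 hp _
    _ = _ := by
        have := Finset.prod_univ_sum (fun _ : {i // i ∉ P} => (Finset.univ : Finset (ZMod 2)))
          (fun _ x => bw p x)
        rw [Fintype.piFinset_univ] at this
        rw [← this]
        simp [bw_sum]

def curE (d nb n : ℕ) : (Fin (d + 1) → Matrix (Fin nb) (Fin n) (ZMod 2)) ≃
    (Fin (d + 1) × Fin nb × Fin n → ZMod 2) where
  toFun ω := fun q => ω q.1 q.2.1 q.2.2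
  invFun x := fun t a b => x (t, a, b)
  left_inv _ := rfl
  right_inv _ := rfl

lemma tupWt_eq (p : ℝ) {d nb n : ℕ} (ω : Fin (d + 1) → Matrix (Fin nb) (Fin n) (ZMod 2)) :
    tupWt p ω = ∏ i, bw p (curE d nb n ω i) := by
  simp only [tupWt, matWt, Fintype.prod_prod_type]
  rfl

lemma tupWt_nonneg {p : ℝ} (hp0 : 0 < p) (hp : p ≤ 1 / 2) {d nb n : ℕ}
    (ω : Fin (d + 1) → Matrix (Fin nb) (Fin n) (ZMod 2)) : 0 ≤ tupWt p ω := by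
  rw [tupWt_eq]; exact Finset.prod_nonneg fun i _ => bw_nonneg hp0 hp _

lemma sol_unique {d nb n : ℕ} (hd : 0 < d) (H1 : Matrix (Fin nb) (Fin n) (ZMod 2))
    (c : Fin d → Fin n → ZMod 2) (b0 : Fin n) (hb0 : c ⟨0, hd⟩ b0 ≠ 0)
    (ω ω' : Fin (d + 1) → Matrix (Fin nb) (Fin n) (ZMod 2))
    (h : Matrix.mulVec (toep nb n (seq H1 ω) d) (flat c) = 0)
    (h' : Matrix.mulVec (toep nb n (seq H1 ω') d) (flat c) = 0)
    (hag : ∀ (t : Fin (d + 1)) (a : Fin nb) (b : Fin n), ¬ (2 ≤ (t : ℕ) ∧ b = b0) → ω t a b = ω' t a b) : ω = ω' := by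
  have key : ∀ m : ℕ, ∀ t : Fin (d + 1), (t : ℕ) = m → ω t = ω' t := by
    intro m
    induction m using Nat.strong_induction_on with
    | _ m ih =>
      intro t ht
      ext a b
      by_cases hP : 2 ≤ (t : ℕ) ∧ b = b0
      swap
      · exact hag t a b hP
      obtain ⟨h2, rfl⟩ := hP
      have htd := t.isLt
      have hi : (t : ℕ) - 1 < d := by omega
      have e := congrFun h (⟨(t : ℕ) - 1, hi⟩, a)
      have e' := congrFun h' (⟨(t : ℕ) - 1, hi⟩, a)
      simp only [Matrix.mulVec, dotProduct, Pi.zero_apply] at e e'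
      rw [← Finset.add_sum_erase _ _ (Finset.mem_univ ((⟨0, hd⟩ : Fin d), b))] at e e'
      have hrest : ∀ q ∈ (Finset.univ : Finset (Fin d × Fin n)).erase ((⟨0, hd⟩ : Fin d), b),
          toep nb n (seq H1 ω) d (⟨(t : ℕ) - 1, hi⟩, a) q * flat c q =
          toep nb n (seq H1 ω') d (⟨(t : ℕ) - 1, hi⟩, a) q * flat c q := by
        rintro ⟨j, b'⟩ hq
        have hq := Finset.ne_of_mem_erase hq
        congr 1
        simp only [toep]
        split_ifs with hj
        swap
        · rfl
        simp only [seq]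
        split_ifs with h3 h4
        · rfl
        · by_cases hj0 : (j : ℕ) = 0
          · have hb : b' ≠ b := by
              rintro rfl
              exact hq (by ext <;> simp [hj0])
            exact hag _ _ _ (fun hh => hb hh.2)
          · rw [ih ((t : ℕ) - 1 - j + 1) (by omega) ⟨_, h4⟩ rfl]
        · rfl
      rw [Finset.sum_congr rfl hrest] at e
      have e3 := add_right_cancel (e.trans e'.symm)
      have e4 := mul_right_cancel₀ (show flat c ((⟨0, hd⟩ : Fin d), b) ≠ 0 from hb0) e3
      have h5 : (t : ℕ) - 1 - 0 + 1 = t := by omega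
      have h6 : (t : ℕ) ≠ 1 := by omega
      have h7 : (t : ℕ) < d + 1 := t.isLt
      simp only [toep, Nat.zero_le, if_true, h5, seq, if_neg h6, dif_pos h7] at e4
      exact e4
  funext t
  exact key _ t rfl

lemma pivot_card (d : ℕ) :
    (Finset.univ.filter fun t : Fin (d + 1) => 2 ≤ (t : ℕ)).card = d - 1 := by
  have h := Finset.card_image_of_injective (Finset.univ.filter fun t : Fin (d + 1) => 2 ≤ (t : ℕ))
    Fin.val_injective
  rw [← h]
  have : (Finset.univ.filter fun t : Fin (d + 1) => 2 ≤ (t : ℕ)).image Fin.val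
      = Finset.Ico 2 (d + 1) := by
    ext m
    simp only [Finset.mem_image, Finset.mem_filter, Finset.mem_univ, true_and, Finset.mem_Ico]
    constructor
    · rintro ⟨t, h2, rfl⟩
      exact ⟨h2, t.isLt⟩
    · rintro ⟨h2, h3⟩
      exact ⟨⟨m, h3⟩, h2, rfl⟩
  rw [this, Nat.card_Ico]
  omega

lemma prob_bound {p : ℝ} (hp0 : 0 < p) (hp : p ≤ 1 / 2) {d nb n : ℕ} (hd : 0 < d)
    (H1 : Matrix (Fin nb) (Fin n) (ZMod 2))
    (c : Fin d → Fin n → ZMod 2) (hc : c ⟨0, hd⟩ ≠ 0) :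
    (∑ ω : Fin (d + 1) → Matrix (Fin nb) (Fin n) (ZMod 2),
      if Matrix.mulVec (toep nb n (seq H1 ω) d) (flat c) = 0 then tupWt p ω else 0)
      ≤ (1 - p) ^ (nb * (d - 1)) := by
  classical
  obtain ⟨b0, hb0⟩ := Function.ne_iff.mp hc
  let P : Finset (Fin (d + 1) × Fin nb × Fin n) :=
    (Finset.univ.filter fun t : Fin (d + 1) => 2 ≤ (t : ℕ)) ×ˢ Finset.univ ×ˢ {b0}
  have hP : P.card = nb * (d - 1) := by
    simp only [P, Finset.card_product, pivot_card]
    simp [mul_comm]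
  rw [← Finset.sum_filter, ← hP]
  have := core_bound hp0 hp P ((Finset.univ.filter fun ω =>
    Matrix.mulVec (toep nb n (seq H1 ω) d) (flat c) = 0).map (curE d nb n).toEmbedding) ?_
  · rw [Finset.sum_map] at this
    simp only [tupWt_eq]
    exact this
  · intro x hx y hy hxy
    simp only [Finset.mem_map, Finset.mem_filter, Finset.mem_univ, true_and] at hx hy
    obtain ⟨ω, hω, rfl⟩ := hx
    obtain ⟨ω', hω', rfl⟩ := hy
    congr 1
    refine sol_unique hd H1 c b0 hb0 ω ω' hω hω' ?_
    intro t a b hn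
    exact hxy (t, a, b) (by simpa [P, eq_comm] using hn)

lemma count_wt (d n w : ℕ) :
    (Finset.univ.filter fun c : Fin d → Fin n → ZMod 2 => wt c = w).card
      = (n * d).choose w := by
  have h : (n * d).choose w =
      (Finset.powersetCard w (Finset.univ : Finset (Fin d × Fin n))).card := by
    rw [Finset.card_powersetCard]; simp [mul_comm]
  rw [h]
  have hz : ∀ x : ZMod 2, x ≠ 0 → x = 1 := by decide
  refine Finset.card_bij' (fun c _ => Finset.univ.filter fun q => flat c q ≠ 0)
    (fun s _ => fun i j => if (i, j) ∈ s then 1 else 0) ?_ ?_ ?_ ?_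
  · intro c hc
    rw [Finset.mem_powersetCard]
    exact ⟨Finset.subset_univ _, (Finset.mem_filter.mp hc).2⟩
  · intro s hs
    rw [Finset.mem_powersetCard] at hs
    refine Finset.mem_filter.mpr ⟨Finset.mem_univ _, ?_⟩
    simp only [wt, hammingNorm, flat]
    simpa using hs.2
  · intro c hc
    funext i j
    have hm : (i, j) ∈ (Finset.univ.filter fun q => flat c q ≠ 0) ↔ c i j ≠ 0 := by
      rw [Finset.mem_filter]
      simp [flat]
    by_cases h0 : c i j = 0
    · rw [h0]
      exact if_neg fun h => hm.mp h h0
    · rw [hz _ h0]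
      exact if_pos (hm.mpr h0)
  · intro s hs
    ext q
    simp [flat]

lemma part_one {p : ℝ} (hp0 : 0 < p) (hp : p ≤ 1 / 2) {d nb n : ℕ} (hd : 0 < d)
    (H1 : Matrix (Fin nb) (Fin n) (ZMod 2)) (w : ℕ) :
    (∑ ω : Fin (d + 1) → Matrix (Fin nb) (Fin n) (ZMod 2),
        tupWt p ω * (numW nb n (seq H1 ω) d hd w : ℝ))
      ≤ (Nat.choose (n * d) w : ℝ) * (1 - p) ^ (nb * (d - 1)) := by
  classical
  have h1 : ∀ ω : Fin (d + 1) → Matrix (Fin nb) (Fin n) (ZMod 2),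
      tupWt p ω * (numW nb n (seq H1 ω) d hd w : ℝ) =
      ∑ c ∈ (Finset.univ.filter fun c : Fin d → Fin n → ZMod 2 => wt c = w).filter
        (fun c => c ⟨0, hd⟩ ≠ 0),
        if Matrix.mulVec (toep nb n (seq H1 ω) d) (flat c) = 0 then tupWt p ω else 0 := by
    intro ω
    rw [← Finset.sum_filter, Finset.sum_const, nsmul_eq_mul, mul_comm]
    congr 2
    unfold numW Cset
    congr 1
    ext c
    simp only [Finset.mem_filter, Finset.mem_univ, true_and]
    tauto
  rw [Finset.sum_congr rfl fun ω _ => h1 ω, Finset.sum_comm]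
  have hnn : (0 : ℝ) ≤ (1 - p) ^ (nb * (d - 1)) := pow_nonneg (by linarith) _
  calc _ ≤ ∑ c ∈ (Finset.univ.filter fun c : Fin d → Fin n → ZMod 2 => wt c = w).filter
        (fun c => c ⟨0, hd⟩ ≠ 0), (1 - p) ^ (nb * (d - 1)) :=
        Finset.sum_le_sum fun c hc => prob_bound hp0 hp hd H1 c (Finset.mem_filter.mp hc).2
    _ ≤ ∑ c ∈ (Finset.univ.filter fun c : Fin d → Fin n → ZMod 2 => wt c = w),
          (1 - p) ^ (nb * (d - 1)) :=
        Finset.sum_le_sum_of_subset_of_nonneg (Finset.filter_subset _ _) fun _ _ _ => hnn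
    _ = _ := by rw [Finset.sum_const, count_wt, nsmul_eq_mul]

lemma choose_le_entropy (N w : ℕ) (hw1 : 1 ≤ w) (hw : w ≤ N) :
    (N.choose w : ℝ) ≤ 2 ^ ((N : ℝ) * binH ((w : ℝ) / N)) := by
  have hN : (0 : ℝ) < N := by exact_mod_cast (by omega : 0 < N)
  have hw0 : (0 : ℝ) < w := by exact_mod_cast hw1
  rcases hw.eq_or_lt with rfl | hlt
  · simp [binH, div_self hN.ne']
  have hlt' : (w : ℝ) < N := by exact_mod_cast hlt
  set x : ℝ := (w : ℝ) / N with hx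
  have hx0 : 0 < x := by positivity
  have hx1 : 0 < 1 - x := by rw [hx, sub_pos, div_lt_one hN]; exact hlt'
  have hxw : (N : ℝ) * x = w := by rw [hx]; field_simp
  have hbin : x ^ w * (1 - x) ^ (N - w) * (N.choose w : ℝ) ≤ 1 := by
    have h := add_pow x (1 - x) N
    rw [add_sub_cancel, one_pow] at h
    refine le_of_le_of_eq ?_ h.symm
    exact Finset.single_le_sum (f := fun m => x ^ m * (1 - x) ^ (N - m) * (N.choose m : ℝ))
      (fun m _ => by positivity) (Finset.mem_range.mpr (by omega : w < N + 1))
  have hE : (2 : ℝ) ^ ((N : ℝ) * binH x) = (x ^ w * (1 - x) ^ (N - w))⁻¹ := by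
    have e1 : (N : ℝ) * binH x =
        -(Real.logb 2 x * w + Real.logb 2 (1 - x) * ((N - w : ℕ) : ℝ)) := by
      rw [Nat.cast_sub hw, ← hxw]; unfold binH; ring
    rw [e1, Real.rpow_neg (by norm_num), Real.rpow_add (by norm_num),
      Real.rpow_mul (by norm_num), Real.rpow_mul (by norm_num),
      Real.rpow_logb (by norm_num) (by norm_num) hx0,
      Real.rpow_logb (by norm_num) (by norm_num) hx1, Real.rpow_natCast, Real.rpow_natCast]
  rw [hE, ← one_div, le_div_iff₀ (by positivity)]
  linarith

theorem toeplitz_weight_enumerator_bounds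
    (k n : ℕ) (hk : 0 < k) (hkn : k < n)
    (p : ℝ) (hp0 : 0 < p) (hp : p ≤ 1 / 2)
    (d : ℕ) (hd : 0 < d)
    (H1 : Matrix (Fin (n - k)) (Fin n) (ZMod 2))
    (w : ℕ) (hw1 : 1 ≤ w) (hwnd : w ≤ n * d) :
    (∑ ω : Fin (d + 1) → Matrix (Fin (n - k)) (Fin n) (ZMod 2),
        tupWt p ω * (numW (n - k) n (seq H1 ω) d hd w : ℝ)
      ≤ (Nat.choose (n * d) w : ℝ) * (1 - p) ^ ((n - k) * (d - 1))) ∧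
    (∀ θ : ℝ, 0 < θ →
      prOmega p d (fun ω =>
          (2 : ℝ) ^ (θ * w) < (numW (n - k) n (seq H1 ω) d hd w : ℝ))
        ≤ (1 - p) ^ (-((n - k : ℕ) : ℝ)) *
          2 ^ (-((n * d : ℕ) : ℝ) *
            (θ * w / (n * d) - binH ((w : ℝ) / (n * d)) +
              (1 - (k : ℝ) / n) * Real.logb 2 (1 / (1 - p))))) := by
  have h1 := part_one hp0 hp hd H1 w
  refine ⟨h1, fun θ hθ => ?_⟩
  have hq : 0 < 1 - p := by linarith
  have hn : (0 : ℝ) < n := by exact_mod_cast (by omega : 0 < n)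
  have hdr : (0 : ℝ) < d := by exact_mod_cast hd
  have ht : (0 : ℝ) < 2 ^ (θ * w) := Real.rpow_pos_of_pos (by norm_num) _
  have hmarkov : prOmega p d (fun ω =>
          (2 : ℝ) ^ (θ * w) < (numW (n - k) n (seq H1 ω) d hd w : ℝ)) * 2 ^ (θ * w) ≤
      ∑ ω : Fin (d + 1) → Matrix (Fin (n - k)) (Fin n) (ZMod 2),
        tupWt p ω * (numW (n - k) n (seq H1 ω) d hd w : ℝ) := by
    unfold prOmega
    rw [Finset.sum_mul]
    refine Finset.sum_le_sum fun ω _ => ?_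
    have := tupWt_nonneg hp0 hp ω
    split_ifs with hS
    · exact mul_le_mul_of_nonneg_left hS.le this
    · rw [zero_mul]; positivity
  have hent := choose_le_entropy (n * d) w hw1 hwnd
  have hpow : (1 - p) ^ ((n - k) * (d - 1)) =
      (1 - p) ^ (-((n - k : ℕ) : ℝ)) * (1 - p) ^ (((n - k : ℕ) : ℝ) * d) := by
    rw [← Real.rpow_add hq, ← Real.rpow_natCast]
    congr 1
    push_cast [Nat.cast_sub hd]
    ring
  have hR : (1 - p) ^ (-((n - k : ℕ) : ℝ)) *
          2 ^ (-((n * d : ℕ) : ℝ) *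
            (θ * w / (n * d) - binH ((w : ℝ) / (n * d)) +
              (1 - (k : ℝ) / n) * Real.logb 2 (1 / (1 - p)))) =
      2 ^ (((n * d : ℕ) : ℝ) * binH ((w : ℝ) / (n * d : ℕ))) *
        (1 - p) ^ ((n - k) * (d - 1)) / 2 ^ (θ * w) := by
    have e : -((n * d : ℕ) : ℝ) *
            (θ * w / (n * d) - binH ((w : ℝ) / (n * d)) +
              (1 - (k : ℝ) / n) * Real.logb 2 (1 / (1 - p))) =
        ((n * d : ℕ) : ℝ) * binH ((w : ℝ) / (n * d : ℕ)) +
          Real.logb 2 (1 - p) * (((n - k : ℕ) : ℝ) * d) - θ * w := by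
      rw [one_div, Real.logb_inv, Nat.cast_sub hkn.le, Nat.cast_mul]
      field_simp
      ring
    rw [e, Real.rpow_sub (by norm_num), Real.rpow_add (by norm_num),
      Real.rpow_mul (by norm_num) (Real.logb 2 (1 - p)),
      Real.rpow_logb (by norm_num) (by norm_num) hq, hpow]
    ring
  rw [hR, le_div_iff₀ ht]
  refine (hmarkov.trans h1).trans ?_
  exact mul_le_mul_of_nonneg_right hent (by positivity)
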